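/- In the ring of formal power series ℤ[[q]] one has ∏_{k≥1} (1 − q^k)^{−1} = Σ_{m≥0} q^{m²} / ((q;q)_m)², where each factor (q;q)_m is inverted as a unit of ℤ[[q]] and the series on the right converges in the q-adic topology (the m-th summand is divisible by q^{m²}). -/

import Mathlib

noncomputable section

/-- The product (coefficient-wise) topology on `ℤ[[q]]`, with `ℤ` carrying its usual
(discrete) topology.  In this topology a series of power series converges iff each
coefficient eventually stabilizes; in particular q-adically convergent sums and products
converge. -/
instance : TopologicalSpace (PowerSeries ℤ) :=
  inferInstanceAs (TopologicalSpace ((Unit →₀ ℕ) → ℤ))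

/-- The q-Pochhammer symbol `(z; q)_M = ∏_{k=1}^M (1 - z q^{k-1})`. -/
def qPoch {F : Type*} [CommRing F] (q z : F) (M : ℕ) : F :=
  ∏ k ∈ Finset.range M, (1 - z * q ^ k)

open Filter PowerSeries

/-- A family of power series converges coefficient-wise if each coefficient stabilizes. -/
theorem tendsto_of_eventually_coeff_eq {ι : Type*} {l : Filter ι} {f : ι → PowerSeries ℤ}
    {g : PowerSeries ℤ} (h : ∀ n, ∀ᶠ i in l, coeff n (f i) = coeff n g) :
    Tendsto f l (nhds g) := by
  refine (tendsto_pi_nhds (f := f) (g := g) (u := l)).2 fun d => ?_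
  refine tendsto_const_nhds.congr' ?_
  obtain ⟨n, rfl⟩ : ∃ n : ℕ, d = Finsupp.single () n :=
    ⟨d (), Finsupp.unique_ext (by simp)⟩
  filter_upwards [h n] with i hi
  exact hi.symm

instance : T2Space (PowerSeries ℤ) :=
  inferInstanceAs (T2Space ((Unit →₀ ℕ) → ℤ))

theorem inverse_one_sub_X_pow_mul (k : ℕ) :
    Ring.inverse (1 - (X : PowerSeries ℤ) ^ (k + 1)) * (1 - X ^ (k + 1)) = 1 :=
  Ring.inverse_mul_cancel _ (isUnit_iff_constantCoeff.2 (by simp))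

theorem inverse_qPoch_eq_prod (m : ℕ) :
    Ring.inverse (qPoch (X : PowerSeries ℤ) X m) =
      ∏ k ∈ Finset.range m, Ring.inverse (1 - (X : PowerSeries ℤ) ^ (k + 1)) := by
  have h : (∏ k ∈ Finset.range m, Ring.inverse (1 - (X : PowerSeries ℤ) ^ (k + 1))) *
      qPoch (X : PowerSeries ℤ) X m = 1 := by
    rw [qPoch, ← Finset.prod_mul_distrib]
    refine Finset.prod_eq_one fun k _ => ?_
    rw [← pow_succ', inverse_one_sub_X_pow_mul]
  have hu : IsUnit (qPoch (X : PowerSeries ℤ) X m) := .of_mul_eq_one_right _ h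
  rw [(Ring.eq_mul_inverse_iff_mul_eq _ _ _ hu).2 h, one_mul]

theorem inverse_qPoch_succ_mul (m : ℕ) :
    Ring.inverse (qPoch (X : PowerSeries ℤ) X (m + 1)) * (1 - X ^ (m + 1)) =
      Ring.inverse (qPoch (X : PowerSeries ℤ) X m) := by
  rw [inverse_qPoch_eq_prod, inverse_qPoch_eq_prod, Finset.prod_range_succ, mul_assoc,
    inverse_one_sub_X_pow_mul, mul_one]

theorem coeff_eq_of_X_pow_dvd_sub {n N : ℕ} (hn : n < N) {f g : PowerSeries ℤ}
    (h : X ^ N ∣ f - g) : coeff n f = coeff n g := by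
  rw [← sub_eq_zero, ← map_sub]
  exact X_pow_dvd_iff.1 h n hn

/-- The series `q^{m (m + a)} / ((q; q)_m (q; q)_{m + a})`, the generating function of partitions with
Durfee rectangle of size `m × (m + a)`. -/
def durfeeTerm (a m : ℕ) : PowerSeries ℤ :=
  X ^ (m * (m + a)) * Ring.inverse (qPoch (X : PowerSeries ℤ) X m) *
    Ring.inverse (qPoch (X : PowerSeries ℤ) X (m + a))

theorem sum_durfeeTerm_succ (a M : ℕ) :
    ∑ m ∈ Finset.range M, durfeeTerm (a + 1) m =
      ∑ m ∈ Finset.range M, durfeeTerm a m + durfeeTerm a M * (1 - X ^ M) := by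
  induction M with
  | zero => simp
  | succ M ih =>
    rw [Finset.sum_range_succ, Finset.sum_range_succ, ih]
    simp only [durfeeTerm]
    have h₁ := inverse_qPoch_succ_mul M
    have h₂ := inverse_qPoch_succ_mul (M + a)
    rw [show M + 1 + a = M + a + 1 by ring, show M + (a + 1) = M + a + 1 by ring,
      ← h₂, ← h₁]
    ring

theorem coeff_sum_durfeeTerm (n a : ℕ) :
    coeff n (∑ m ∈ Finset.range (n + 1), durfeeTerm a m) =
      coeff n (∑ m ∈ Finset.range (n + 1), durfeeTerm 0 m) := by
  induction a with
  | zero => rfl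
  | succ a ih =>
    rw [← ih, sum_durfeeTerm_succ]
    refine coeff_eq_of_X_pow_dvd_sub (N := (n + 1) * (n + 1 + a)) (by nlinarith) ?_
    rw [add_sub_cancel_left, durfeeTerm, mul_assoc, mul_assoc]
    exact dvd_mul_right _ _

theorem coeff_sum_durfeeTerm_zero (n : ℕ) :
    coeff n (∑ m ∈ Finset.range (n + 1), durfeeTerm 0 m) =
      coeff n (Ring.inverse (qPoch (X : PowerSeries ℤ) X n)) := by
  rw [← coeff_sum_durfeeTerm n n]
  refine coeff_eq_of_X_pow_dvd_sub n.lt_succ_self ?_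
  have h : durfeeTerm n 0 = Ring.inverse (qPoch (X : PowerSeries ℤ) X n) := by
    simp [durfeeTerm, qPoch]
  rw [Finset.sum_range_succ', h, add_sub_cancel_right]
  refine Finset.dvd_sum fun m _ => ?_
  rw [durfeeTerm, mul_assoc]
  exact (pow_dvd_pow X (by nlinarith)).mul_right _

/-- The generating function of partitions: only parts of size at most `n` contribute to the
`n`-th coefficient. -/
def partitionSeries : PowerSeries ℤ :=
  mk fun n => coeff n (Ring.inverse (qPoch (X : PowerSeries ℤ) X n))

theorem hasSum_durfeeTerm : HasSum (durfeeTerm 0) partitionSeries := by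
  refine tendsto_of_eventually_coeff_eq fun n => ?_
  filter_upwards [eventually_ge_atTop (Finset.range (n + 1))] with s hs
  rw [partitionSeries, coeff_mk, ← coeff_sum_durfeeTerm_zero]
  refine coeff_eq_of_X_pow_dvd_sub n.lt_succ_self ?_
  rw [← Finset.sum_sdiff hs, add_sub_cancel_right]
  refine Finset.dvd_sum fun m hm => ?_
  have hm' : n + 1 ≤ m := by simpa using (Finset.mem_sdiff.1 hm).2
  rw [durfeeTerm, mul_assoc]
  exact (pow_dvd_pow X (by nlinarith)).mul_right _

theorem X_pow_dvd_inverse_sub_one {N k : ℕ} (h : N ≤ k + 1) :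
    X ^ N ∣ Ring.inverse (1 - (X : PowerSeries ℤ) ^ (k + 1)) - 1 := by
  refine (pow_dvd_pow X h).trans ⟨Ring.inverse (1 - (X : PowerSeries ℤ) ^ (k + 1)), ?_⟩
  linear_combination inverse_one_sub_X_pow_mul k

theorem hasProd_inverse_one_sub_X_pow :
    HasProd (fun k : ℕ => Ring.inverse (1 - (X : PowerSeries ℤ) ^ (k + 1)))
      partitionSeries := by
  refine tendsto_of_eventually_coeff_eq fun n => ?_
  filter_upwards [eventually_ge_atTop (Finset.range n)] with s hs
  rw [partitionSeries, coeff_mk, inverse_qPoch_eq_prod]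
  refine coeff_eq_of_X_pow_dvd_sub n.lt_succ_self ?_
  rw [← Finset.prod_sdiff hs, ← sub_one_mul]
  refine Dvd.dvd.mul_right ?_ _
  refine Finset.prod_induction _ (fun f : PowerSeries ℤ => X ^ (n + 1) ∣ f - 1) ?_ (by simp) ?_
  · intro f g hf hg
    rw [show f * g - 1 = (f - 1) * g + (g - 1) by ring]
    exact (hf.mul_right g).add hg
  · intro k hk
    have hk' : n ≤ k := by simpa using (Finset.mem_sdiff.1 hk).2
    exact X_pow_dvd_inverse_sub_one (by lia)

/-- Euler's Durfee square identity.  In `ℤ[[q]]`,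
`∏_{k≥1} (1 - q^k)⁻¹ = Σ_{m≥0} q^{m²} / ((q;q)_m)²`, where each factor `(q;q)_m`
(constant coefficient `1`) is inverted as a unit of `ℤ[[q]]` (via `Ring.inverse`), and
the series on the right converges in the q-adic (coefficient-wise) topology since the
`m`-th summand is divisible by `q^{m²}`. -/
theorem durfee_square_identity :
    (∏' k : ℕ, Ring.inverse (1 - (PowerSeries.X : PowerSeries ℤ) ^ (k + 1))) =
      ∑' m : ℕ,
        (PowerSeries.X : PowerSeries ℤ) ^ (m ^ 2) *
          (Ring.inverse (qPoch (PowerSeries.X : PowerSeries ℤ) PowerSeries.X m)) ^ 2 := by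
  rw [hasProd_inverse_one_sub_X_pow.tprod_eq, ← hasSum_durfeeTerm.tsum_eq]
  refine tsum_congr fun m => ?_
  rw [durfeeTerm, add_zero]
  ring
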